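/- arXiv:2306.00096 — 5 statements merged into one kernel-verified Lean document; each statement's English description precedes it below -/
import Mathlib

section
/- Let x_1, ..., x_K be vectors in ℝ^d that span ℝ^d. Then the design matrix D = (1/d) Σ_{k'=1}^K x_{k'} x_{k'}ᵀ is invertible and satisfies the G-optimal-design property max_{k∈{1,...,K}} x_kᵀ D⁻¹ x_k ≤ d. -/
open Matrix

/-- The quadratic form of the Gram-type matrix `c • ∑ i, x i (x i)ᵀ`. -/
theorem dotProduct_smul_sum_vecMulVec_mulVec {ι n : Type*} [Fintype ι] [Fintype n]
    (c : ℝ) (x : ι → n → ℝ) (v : n → ℝ) :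
    v ⬝ᵥ ((c • ∑ i, vecMulVec (x i) (x i)) *ᵥ v) = c * ∑ i, (x i ⬝ᵥ v) ^ 2 := by
  simp only [smul_mulVec, sum_mulVec, dotProduct_smul, dotProduct_sum, smul_eq_mul,
    vecMulVec_mulVec]
  congr 1
  refine Finset.sum_congr rfl fun i _ => ?_
  simp [dotProduct_comm v, sq]

/-- A vector orthogonal to a spanning family vanishes. -/
theorem eq_zero_of_forall_dotProduct_eq_zero {ι n : Type*} [Fintype n] {x : ι → n → ℝ}
    (hspan : Submodule.span ℝ (Set.range x) = ⊤) {v : n → ℝ} (hv : ∀ i, x i ⬝ᵥ v = 0) :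
    v = 0 := by
  rw [← dotProduct_self_eq_zero]
  have hmem : v ∈ Submodule.span ℝ (Set.range x) := hspan ▸ Submodule.mem_top
  refine Submodule.span_induction (p := fun w _ => w ⬝ᵥ v = 0) ?_ (by simp) ?_ ?_ hmem
  · rintro _ ⟨i, rfl⟩
    exact hv i
  · intro a b _ _ ha hb
    simp [add_dotProduct, ha, hb]
  · intro r a _ ha
    simp [ha]

theorem isUnit_smul_sum_vecMulVec {ι n : Type*} [Fintype ι] [Fintype n] [DecidableEq n]
    {c : ℝ} (hc : c ≠ 0) {x : ι → n → ℝ} (hspan : Submodule.span ℝ (Set.range x) = ⊤) :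
    IsUnit (c • ∑ i, vecMulVec (x i) (x i)) := by
  rw [← mulVec_injective_iff_isUnit, ← coe_mulVecLin, injective_iff_map_eq_zero]
  intro v hv
  have hquad := dotProduct_smul_sum_vecMulVec_mulVec c x v
  rw [← mulVecLin_apply, hv, dotProduct_zero, eq_comm, mul_eq_zero, or_iff_right hc,
    Finset.sum_eq_zero_iff_of_nonneg fun i _ => sq_nonneg _] at hquad
  exact eq_zero_of_forall_dotProduct_eq_zero hspan fun i =>
    pow_eq_zero_iff two_ne_zero |>.mp (hquad i (Finset.mem_univ i))

/-- With `D = c • ∑ i, x i (x i)ᵀ` and `c > 0`, each `x k` has squared `D⁻¹`-norm at most `c⁻¹`. -/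
theorem dotProduct_inv_smul_sum_vecMulVec_mulVec_le {ι n : Type*} [Fintype ι] [Fintype n]
    [DecidableEq n] {c : ℝ} (hc : 0 < c) {x : ι → n → ℝ}
    (hD : IsUnit (c • ∑ i, vecMulVec (x i) (x i))) (k : ι) :
    x k ⬝ᵥ ((c • ∑ i, vecMulVec (x i) (x i))⁻¹ *ᵥ x k) ≤ c⁻¹ := by
  set y := (c • ∑ i, vecMulVec (x i) (x i))⁻¹ *ᵥ x k with hy
  have hquad := dotProduct_smul_sum_vecMulVec_mulVec c x y
  rw [hy, mulVec_mulVec, mul_nonsing_inv _ ((isUnit_iff_isUnit_det _).mp hD), one_mulVec, ← hy,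
    dotProduct_comm] at hquad
  have hterm : (x k ⬝ᵥ y) ^ 2 ≤ ∑ i, (x i ⬝ᵥ y) ^ 2 :=
    Finset.single_le_sum (f := fun i => (x i ⬝ᵥ y) ^ 2) (fun i _ => sq_nonneg _)
      (Finset.mem_univ k)
  have hmul := mul_le_mul_of_nonneg_left hterm hc.le
  rw [← hquad] at hmul
  rw [← one_div, le_div_iff₀ hc]
  nlinarith

/-- If `x 1, …, x K` span `ℝ^d`, then the design matrix
`D = (1/d) ∑ k', x k' (x k')ᵀ` is invertible and `max_k x kᵀ D⁻¹ x k ≤ d`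
(the G-optimal-design property). -/
theorem design_matrix_G_optimal (d K : ℕ) (x : Fin K → (Fin d → ℝ))
    (hspan : Submodule.span ℝ (Set.range x) = ⊤) :
    IsUnit ((d : ℝ)⁻¹ • ∑ k' : Fin K, vecMulVec (x k') (x k')) ∧
      ∀ k : Fin K,
        x k ⬝ᵥ (((d : ℝ)⁻¹ • ∑ k' : Fin K, vecMulVec (x k') (x k'))⁻¹ *ᵥ x k) ≤ d := by
  rcases Nat.eq_zero_or_pos d with rfl | hd
  · exact ⟨isUnit_of_subsingleton _, fun k => by simp⟩
  have hc : (0 : ℝ) < (d : ℝ)⁻¹ := by positivity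
  have hD := isUnit_smul_sum_vecMulVec hc.ne' hspan
  exact ⟨hD, fun k => by simpa using dotProduct_inv_smul_sum_vecMulVec_mulVec_le hc hD k⟩
end

section
/- Matrix Hoeffding inequality for martingales: let (Ω, 𝔉, ℙ) be a probability space, (𝔉_τ)_{τ=0}^{t} a filtration, and (M_τ)_{τ=1}^{t} an adapted, integrable process taking values in d×d real matrices (M_τ is 𝔉_τ-measurable). Suppose each M_τ is almost surely symmetric, and for some b > 0 every eigenvalue of the difference D_τ := M_τ − 𝔼[M_τ | 𝔉_{τ−1}] lies in [−b, b] almost surely. Then for every x > 0, ℙ( ‖Σ_{τ=1}^{t} D_τ‖₂ ≥ x ) ≤ 2d · exp( −x² / (2 t b²) ), where ‖·‖₂ denotes the spectral (ℓ₂ operator) norm. -/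
open Matrix MeasureTheory

/-- The spectral (ℓ₂-operator) norm of a real square matrix. -/
noncomputable def specNorm {d : ℕ} (M : Matrix (Fin d) (Fin d) ℝ) : ℝ :=
  ‖Matrix.toEuclideanCLM (𝕜 := ℝ) M‖

section Deterministic

variable {n : Type*} [Fintype n] [DecidableEq n]

/-- Orthogonal diagonalization of a real symmetric matrix. -/
lemma Matrix.IsSymm.exists_orthogonal_diagonalization {A : Matrix n n ℝ} (hA : A.IsSymm) :
    ∃ (U : Matrix n n ℝ) (l : n → ℝ), Uᵀ * U = 1 ∧ U * Uᵀ = 1 ∧ A = U * diagonal l * Uᵀ ∧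
      ∀ i, ∃ v : n → ℝ, v ≠ 0 ∧ A *ᵥ v = l i • v := by
  have hH : A.IsHermitian := by
    rw [Matrix.IsHermitian, conjTranspose_eq_transpose_of_trivial]; exact hA
  have hstar : star (hH.eigenvectorUnitary : Matrix n n ℝ)
      = (hH.eigenvectorUnitary : Matrix n n ℝ)ᵀ := by
    rw [star_eq_conjTranspose, conjTranspose_eq_transpose_of_trivial]
  refine ⟨hH.eigenvectorUnitary, hH.eigenvalues, ?_, ?_, ?_, fun i => ?_⟩
  · rw [← hstar]; exact Unitary.coe_star_mul_self _
  · rw [← hstar]; exact Unitary.coe_mul_star_self _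
  · have h := hH.spectral_theorem
    rw [Unitary.conjStarAlgAut_apply, hstar] at h
    exact h
  · refine ⟨hH.eigenvectorBasis i, fun h => ?_, hH.mulVec_eigenvectorBasis i⟩
    have h1 := hH.eigenvectorBasis.orthonormal.1 i
    have h2 : hH.eigenvectorBasis i = 0 := by
      ext j; exact congrFun h j
    simp [h2] at h1

lemma orthogonal_conj_pow {U : Matrix n n ℝ} (hU : Uᵀ * U = 1) (hU' : U * Uᵀ = 1) (l : n → ℝ)
    (k : ℕ) : (U * diagonal l * Uᵀ) ^ k = U * diagonal (l ^ k) * Uᵀ := by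
  induction k with
  | zero => simp [hU']
  | succ k ih =>
    rw [pow_succ, ih]
    calc U * diagonal (l ^ k) * Uᵀ * (U * diagonal l * Uᵀ)
        = U * diagonal (l ^ k) * (Uᵀ * U) * diagonal l * Uᵀ := by simp only [Matrix.mul_assoc]
      _ = _ := by
        rw [hU, Matrix.mul_one, Matrix.mul_assoc U, diagonal_mul_diagonal]; rfl

lemma trace_orthogonal_conj_diagonal {U : Matrix n n ℝ} (hU : Uᵀ * U = 1) (l : n → ℝ) :
    trace (U * diagonal l * Uᵀ) = ∑ i, l i := by
  rw [trace_mul_comm, ← Matrix.mul_assoc, hU, Matrix.one_mul, trace_diagonal]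

lemma trace_even_pow_nonneg {A : Matrix n n ℝ} (hA : A.IsSymm) (k : ℕ) :
    0 ≤ trace (A ^ (2 * k)) := by
  obtain ⟨U, l, hU, hU', rfl, -⟩ := hA.exists_orthogonal_diagonalization
  rw [orthogonal_conj_pow hU hU', trace_orthogonal_conj_diagonal hU]
  exact Finset.sum_nonneg fun i _ => (even_two_mul k).pow_nonneg _

/-- A symmetric matrix whose eigenvalues lie in `[-c, c]` is bounded by `c`. -/
lemma dotProduct_mulVec_self_le_of_eigenvalues {U : Matrix n n ℝ} (hU : Uᵀ * U = 1)
    (hU' : U * Uᵀ = 1) {l : n → ℝ} {c : ℝ} (hl : ∀ i, |l i| ≤ c) (v : n → ℝ) :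
    ((U * diagonal l * Uᵀ) *ᵥ v) ⬝ᵥ ((U * diagonal l * Uᵀ) *ᵥ v) ≤ c ^ 2 * (v ⬝ᵥ v) := by
  have iso : ∀ {V : Matrix n n ℝ}, Vᵀ * V = 1 → ∀ w : n → ℝ, (V *ᵥ w) ⬝ᵥ (V *ᵥ w) = w ⬝ᵥ w := by
    intro V hV w
    rw [dotProduct_mulVec, ← mulVec_transpose, mulVec_mulVec, hV, one_mulVec]
  have hw := iso (V := Uᵀ) (by simpa using hU') v
  rw [← mulVec_mulVec, ← mulVec_mulVec, iso hU, ← hw]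
  simp only [dotProduct, mulVec_diagonal, Finset.mul_sum]
  refine Finset.sum_le_sum fun i _ => ?_
  have h := sq_le_sq' (abs_le.1 (hl i)).1 (abs_le.1 (hl i)).2
  nlinarith [mul_le_mul_of_nonneg_right h (sq_nonneg ((Uᵀ *ᵥ v) i))]

lemma pow_mul_pow_add_le {a c : ℝ} (ha : 0 ≤ a) (hc : 0 ≤ c) (p q : ℕ) :
    a ^ p * c ^ q + a ^ q * c ^ p ≤ a ^ (p + q) + c ^ (p + q) := by
  have h : 0 ≤ (a ^ p - c ^ p) * (a ^ q - c ^ q) := by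
    rcases le_total a c with h | h
    · exact mul_nonneg_of_nonpos_of_nonpos (sub_nonpos.2 (pow_le_pow_left₀ ha h _))
        (sub_nonpos.2 (pow_le_pow_left₀ ha h _))
    · exact mul_nonneg (sub_nonneg.2 (pow_le_pow_left₀ hc h _))
        (sub_nonneg.2 (pow_le_pow_left₀ hc h _))
  rw [pow_add, pow_add]; nlinarith

/-- For symmetric `A`, `D` with `D² ≤ b²`, one has `tr (D A^p D A^q) ≤ b² tr A^(p+q)` when `p + q`
is even. -/
lemma trace_mul_pow_mul_pow_le {A D : Matrix n n ℝ} (hA : A.IsSymm) (hD : D.IsSymm) {b : ℝ}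
    (hDb : ∀ v : n → ℝ, (D *ᵥ v) ⬝ᵥ (D *ᵥ v) ≤ b ^ 2 * (v ⬝ᵥ v)) {p q k : ℕ}
    (hpq : p + q = 2 * k) :
    trace (D * (A ^ p * D * A ^ q)) ≤ b ^ 2 * trace (A ^ (2 * k)) := by
  obtain ⟨U, l, hU, hU', rfl, -⟩ := hA.exists_orthogonal_diagonalization
  simp only [orthogonal_conj_pow hU hU', trace_orthogonal_conj_diagonal hU]
  set E := Uᵀ * D * U with hE
  have hEs : ∀ i j, E i j = E j i := by
    have : Eᵀ = E := by
      simp only [hE, transpose_mul, transpose_transpose, hD.eq, Matrix.mul_assoc]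
    intro i j; exact congrFun (congrFun this j) i
  have htr : trace (D * (U * diagonal (l ^ p) * Uᵀ * D * (U * diagonal (l ^ q) * Uᵀ)))
      = ∑ i, ∑ j, E i j ^ 2 * (l i ^ q * l j ^ p) := by
    have h1 : D * (U * diagonal (l ^ p) * Uᵀ * D * (U * diagonal (l ^ q) * Uᵀ))
      = (D * U * diagonal (l ^ p) * E * diagonal (l ^ q)) * Uᵀ := by
      simp only [hE, Matrix.mul_assoc]
    have h2 : Uᵀ * (D * U * diagonal (l ^ p) * E * diagonal (l ^ q))
      = (E * diagonal (l ^ p)) * (E * diagonal (l ^ q)) := by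
      simp only [hE, Matrix.mul_assoc]
    rw [h1, trace_mul_comm, h2]
    simp only [trace, diag_apply, Matrix.mul_apply (M := E * _), mul_diagonal, Pi.pow_apply]
    refine Finset.sum_congr rfl fun i _ => Finset.sum_congr rfl fun j _ => ?_
    rw [hEs j i]; ring
  have hrow : ∀ i, ∑ j, E i j ^ 2 ≤ b ^ 2 := by
    intro i
    have h := hDb (fun j => U j i)
    have h1 : (fun j => U j i) ⬝ᵥ (fun j => U j i) = 1 := by
      have := congrFun (congrFun hU i) i
      simpa [Matrix.mul_apply, dotProduct] using this
    have h2 : (D *ᵥ fun j => U j i) ⬝ᵥ (D *ᵥ fun j => U j i) = (E * E) i i := by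
      have h3 : E * E = (D * U)ᵀ * (D * U) := by
        calc E * E = Uᵀ * D * (U * Uᵀ) * D * U := by simp only [hE, Matrix.mul_assoc]
          _ = _ := by rw [hU', Matrix.mul_one, transpose_mul, hD.eq]; simp only [Matrix.mul_assoc]
      rw [h3]
      simp only [Matrix.mul_apply, dotProduct, mulVec, transpose_apply]
    rw [h1, h2, Matrix.mul_apply, mul_one] at h
    refine le_trans (le_of_eq (Finset.sum_congr rfl fun j _ => ?_)) h
    rw [hEs j i, sq]
  have habs : ∀ i, |l i| ^ (2 * k) = l i ^ (2 * k) := fun i => (even_two_mul k).pow_abs _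
  have hswap : ∑ i, ∑ j, E i j ^ 2 * (|l i| ^ q * |l j| ^ p)
      = ∑ i, ∑ j, E i j ^ 2 * (|l i| ^ p * |l j| ^ q) := by
    rw [Finset.sum_comm]
    refine Finset.sum_congr rfl fun i _ => Finset.sum_congr rfl fun j _ => ?_
    rw [hEs j i]; ring
  have hswap' : ∑ i, ∑ j, E i j ^ 2 * l j ^ (2 * k) = ∑ i, ∑ j, E i j ^ 2 * l i ^ (2 * k) := by
    rw [Finset.sum_comm]
    refine Finset.sum_congr rfl fun i _ => Finset.sum_congr rfl fun j _ => ?_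
    rw [hEs j i]
  have h1 : ∑ i, ∑ j, E i j ^ 2 * (l i ^ q * l j ^ p)
      ≤ ∑ i, ∑ j, E i j ^ 2 * (|l i| ^ q * |l j| ^ p) := by
    refine Finset.sum_le_sum fun i _ => Finset.sum_le_sum fun j _ =>
      mul_le_mul_of_nonneg_left ?_ (sq_nonneg _)
    calc l i ^ q * l j ^ p ≤ |l i ^ q * l j ^ p| := le_abs_self _
      _ = _ := by rw [abs_mul, abs_pow, abs_pow]
  have h2 : ∑ i, ∑ j, E i j ^ 2 * (|l i| ^ q * |l j| ^ p)
      + ∑ i, ∑ j, E i j ^ 2 * (|l i| ^ p * |l j| ^ q)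
      ≤ ∑ i, ∑ j, E i j ^ 2 * l i ^ (2 * k) + ∑ i, ∑ j, E i j ^ 2 * l j ^ (2 * k) := by
    simp only [← Finset.sum_add_distrib]
    refine Finset.sum_le_sum fun i _ => Finset.sum_le_sum fun j _ => ?_
    rw [← mul_add, ← mul_add, ← habs, ← habs, ← hpq, add_comm (_ ^ q * _)]
    exact mul_le_mul_of_nonneg_left (pow_mul_pow_add_le (abs_nonneg _) (abs_nonneg _) p q)
      (sq_nonneg _)
  have h3 : ∑ i, ∑ j, E i j ^ 2 * l i ^ (2 * k) ≤ b ^ 2 * ∑ i, l i ^ (2 * k) := by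
    rw [Finset.mul_sum]
    refine Finset.sum_le_sum fun i _ => ?_
    rw [← Finset.sum_mul]
    exact mul_le_mul_of_nonneg_right (hrow i) ((even_two_mul k).pow_nonneg _)
  rw [htr]
  simp only [Pi.pow_apply]
  linarith

/-- The trace of the Taylor polynomial of `cosh` with `K` terms. -/
noncomputable def traceCosh (K : ℕ) (A : Matrix n n ℝ) : ℝ :=
  ∑ k ∈ Finset.range K, trace (A ^ (2 * k)) / (2 * k).factorial

/-- The derivative of the Taylor polynomial of `cosh` with `K` terms. -/
noncomputable def taylorSinh (K : ℕ) (A : Matrix n n ℝ) : Matrix n n ℝ :=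
  ∑ k ∈ Finset.range K, ((2 * k : ℕ) / (2 * k).factorial : ℝ) • A ^ (2 * k - 1)

lemma traceCosh_nonneg {A : Matrix n n ℝ} (hA : A.IsSymm) (K : ℕ) : 0 ≤ traceCosh K A :=
  Finset.sum_nonneg fun k _ => div_nonneg (trace_even_pow_nonneg hA k) (Nat.cast_nonneg _)

attribute [local instance] Matrix.linftyOpNormedRing Matrix.linftyOpNormedAlgebra

lemma hasDerivAt_pow_add_smul (A D : Matrix n n ℝ) (m : ℕ) (s : ℝ) :
    HasDerivAt (fun s : ℝ => (A + s • D) ^ m)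
      (∑ j ∈ Finset.range m, (A + s • D) ^ (m.pred - j) * D * (A + s • D) ^ j) s := by
  have h : HasDerivAt (fun s : ℝ => A + s • D) D s := by
    exact (((hasDerivAt_id s).smul_const D).const_add A).congr_deriv (one_smul ℝ D)
  exact h.fun_pow' m

lemma HasDerivAt.trace_mul (D : Matrix n n ℝ) {F : ℝ → Matrix n n ℝ} {F' : Matrix n n ℝ} {s : ℝ}
    (h : HasDerivAt F F' s) : HasDerivAt (fun s => trace (D * F s)) (trace (D * F')) s := by
  let L : Matrix n n ℝ →L[ℝ] ℝ :=
    LinearMap.toContinuousLinearMap (Matrix.traceLinearMap n ℝ ℝ ∘ₗ LinearMap.mulLeft ℝ D)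
  exact L.hasFDerivAt.comp_hasDerivAt s h

lemma hasDerivAt_traceCosh (A D : Matrix n n ℝ) (K : ℕ) (s : ℝ) :
    HasDerivAt (fun s : ℝ => traceCosh K (A + s • D))
      (trace (D * taylorSinh K (A + s • D))) s := by
  have h : ∀ k ∈ Finset.range K, HasDerivAt
      (fun s : ℝ => trace ((A + s • D) ^ (2 * k)) / ((2 * k).factorial : ℝ))
      (trace (D * (((2 * k : ℕ) / (2 * k).factorial : ℝ) • (A + s • D) ^ (2 * k - 1)))) s := by
    intro k _
    have h1 := ((hasDerivAt_pow_add_smul A D (2 * k) s).trace_mul 1).div_const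
      ((2 * k).factorial : ℝ)
    simp only [Matrix.one_mul] at h1
    refine h1.congr_deriv ?_
    rw [trace_sum, Finset.sum_congr rfl (g := fun _ => trace (D * (A + s • D) ^ (2 * k - 1)))]
    · simp only [Finset.sum_const, Finset.card_range, nsmul_eq_mul, Matrix.mul_smul, trace_smul,
        smul_eq_mul]
      ring
    · intro j hj
      have := Finset.mem_range.1 hj
      rw [Matrix.mul_assoc, trace_mul_comm, Matrix.mul_assoc, ← pow_add, Nat.pred_eq_sub_one]
      congr 3; omega
  have := HasDerivAt.fun_sum h
  simpa only [traceCosh, taylorSinh, Finset.mul_sum, trace_sum] using this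

lemma trace_mul_taylorSinh (A D : Matrix n n ℝ) (K : ℕ) :
    trace (D * taylorSinh K A) = ∑ k ∈ Finset.range K,
      ((2 * k : ℕ) / (2 * k).factorial : ℝ) * trace (D * A ^ (2 * k - 1)) := by
  simp only [taylorSinh, Finset.mul_sum, trace_sum, Matrix.mul_smul, trace_smul, smul_eq_mul]

lemma exists_hasDerivAt_trace_mul_taylorSinh_le {A D : Matrix n n ℝ} (hA : A.IsSymm)
    (hD : D.IsSymm) {b : ℝ} (hDb : ∀ v : n → ℝ, (D *ᵥ v) ⬝ᵥ (D *ᵥ v) ≤ b ^ 2 * (v ⬝ᵥ v))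
    (K : ℕ) (s : ℝ) :
    ∃ f'', HasDerivAt (fun s : ℝ => trace (D * taylorSinh K (A + s • D))) f'' s ∧
      f'' ≤ b ^ 2 * traceCosh K (A + s • D) := by
  set Y := A + s • D with hY
  have hYs : Y.IsSymm := hA.add (hD.smul s)
  refine ⟨∑ k ∈ Finset.range K, ((2 * k : ℕ) / (2 * k).factorial : ℝ) *
    trace (D * ∑ j ∈ Finset.range (2 * k - 1), Y ^ ((2 * k - 1).pred - j) * D * Y ^ j), ?_, ?_⟩
  · simp only [trace_mul_taylorSinh]
    exact HasDerivAt.fun_sum fun k _ =>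
      ((hasDerivAt_pow_add_smul A D (2 * k - 1) s).trace_mul D).const_mul _
  · cases K with
    | zero => simp [traceCosh]
    | succ K =>
      rw [Finset.sum_range_succ']
      have hle : traceCosh K Y ≤ traceCosh (K + 1) Y := by
        rw [traceCosh, traceCosh, Finset.sum_range_succ]
        exact le_add_of_nonneg_right
          (div_nonneg (trace_even_pow_nonneg hYs K) (Nat.cast_nonneg _))
      refine le_trans ?_ (mul_le_mul_of_nonneg_left hle (sq_nonneg b))
      simp only [mul_zero, Nat.cast_zero, zero_div, zero_mul, add_zero]
      rw [traceCosh, Finset.mul_sum]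
      refine Finset.sum_le_sum fun k _ => ?_
      have h1 : trace (D * ∑ j ∈ Finset.range (2 * (k + 1) - 1),
          Y ^ ((2 * (k + 1) - 1).pred - j) * D * Y ^ j)
          ≤ (2 * k + 1 : ℕ) * (b ^ 2 * trace (Y ^ (2 * k))) := by
        rw [Finset.mul_sum, trace_sum]
        refine (Finset.sum_le_card_nsmul _ _ (b ^ 2 * trace (Y ^ (2 * k))) fun j hj => ?_).trans ?_
        · have := Finset.mem_range.1 hj
          refine trace_mul_pow_mul_pow_le hYs hD hDb ?_
          rw [Nat.pred_eq_sub_one]; omega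
        · rw [Finset.card_range, nsmul_eq_mul, show 2 * (k + 1) - 1 = 2 * k + 1 by omega]
      refine (mul_le_mul_of_nonneg_left h1 (by positivity)).trans (le_of_eq ?_)
      have hf : ((2 * (k + 1)).factorial : ℝ)
          = (2 * (k + 1) : ℕ) * ((2 * k + 1 : ℕ) * (2 * k).factorial) := by
        rw [show 2 * (k + 1) = 2 * k + 1 + 1 by ring, Nat.factorial_succ, Nat.factorial_succ]
        push_cast; ring
      rw [hf]
      have : ((2 * k).factorial : ℝ) ≠ 0 := by positivity
      push_cast
      field_simp

/-- Comparison for the differential inequality `f'' ≤ b² f`. -/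
lemma le_cosh_add_sinh_of_deriv_le {b : ℝ} (hb : 0 < b) {f f' : ℝ → ℝ}
    (hf : ∀ s, HasDerivAt f (f' s) s)
    (hf' : ∀ s, ∃ f'', HasDerivAt f' f'' s ∧ f'' ≤ b ^ 2 * f s) {s : ℝ} (hs : 0 ≤ s) :
    f s ≤ f 0 * Real.cosh (b * s) + f' 0 / b * Real.sinh (b * s) := by
  choose f'' hf'' hle using hf'
  have hlin : ∀ s, HasDerivAt (fun s : ℝ => b * s) b s := fun s => by
    simpa using (hasDerivAt_id s).const_mul b
  have hg : ∀ s, HasDerivAt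
      (fun s => f s - (f 0 * Real.cosh (b * s) + f' 0 / b * Real.sinh (b * s)))
      (f' s - (f 0 * b * Real.sinh (b * s) + f' 0 * Real.cosh (b * s))) s := fun s => by
    refine ((hf s).sub ((((hlin s).cosh).const_mul (f 0)).add
      (((hlin s).sinh).const_mul (f' 0 / b)))).congr_deriv ?_
    field_simp
  have hg' : ∀ s, HasDerivAt
      (fun s => f' s - (f 0 * b * Real.sinh (b * s) + f' 0 * Real.cosh (b * s)))
      (f'' s - b ^ 2 * (f 0 * Real.cosh (b * s) + f' 0 / b * Real.sinh (b * s))) s := fun s => by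
    refine ((hf'' s).sub ((((hlin s).sinh).const_mul (f 0 * b)).add
      (((hlin s).cosh).const_mul (f' 0)))).congr_deriv ?_
    field_simp
  set g := fun s => f s - (f 0 * Real.cosh (b * s) + f' 0 / b * Real.sinh (b * s)) with hgdef
  set g' := fun s => f' s - (f 0 * b * Real.sinh (b * s) + f' 0 * Real.cosh (b * s)) with hg'def
  have hu : ∀ s, HasDerivAt (fun s => (g' s + b * g s) * Real.exp (-(b * s)))
      ((f'' s - b ^ 2 * f s) * Real.exp (-(b * s))) s := fun s => by
    refine (((hg' s).add ((hg s).const_mul b)).mul ((hlin s).neg.exp)).congr_deriv ?_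
    simp only [hgdef, hg'def, Pi.add_apply, Pi.neg_apply]
    field_simp
    ring
  have hu_anti : Antitone fun s => (g' s + b * g s) * Real.exp (-(b * s)) :=
    antitone_of_hasDerivAt_nonpos hu fun s =>
      mul_nonpos_of_nonpos_of_nonneg (sub_nonpos.2 (hle s)) (Real.exp_pos _).le
  have hu_nonpos : ∀ s, 0 ≤ s → g' s + b * g s ≤ 0 := fun s hs => by
    have h := hu_anti hs
    simp only [hgdef, hg'def, mul_zero, Real.cosh_zero, Real.sinh_zero, mul_one, add_zero,
      zero_add, sub_self, zero_mul] at h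
    exact nonpos_of_mul_nonpos_left h (Real.exp_pos _)
  have hv : ∀ s, HasDerivAt (fun s => g s * Real.exp (b * s))
      ((g' s + b * g s) * Real.exp (b * s)) s := fun s => by
    refine ((hg s).mul ((hlin s).exp)).congr_deriv ?_
    ring
  have hv_anti : AntitoneOn (fun s => g s * Real.exp (b * s)) (Set.Ici 0) := by
    refine antitoneOn_of_hasDerivWithinAt_nonpos (convex_Ici 0)
      (fun s _ => (hv s).continuousAt.continuousWithinAt)
      (fun s _ => (hv s).hasDerivWithinAt) fun s hs => ?_
    rw [interior_Ici] at hs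
    exact mul_nonpos_of_nonpos_of_nonneg (hu_nonpos s (le_of_lt hs)) (Real.exp_pos _).le
  have h := hv_anti (Set.mem_Ici.2 le_rfl) (Set.mem_Ici.2 hs) hs
  simp only [hgdef, mul_zero, Real.cosh_zero, Real.sinh_zero, mul_one, add_zero,
      sub_self, zero_mul] at h
  have := nonpos_of_mul_nonpos_left h (Real.exp_pos _)
  linarith

lemma traceCosh_add_smul_le {A D : Matrix n n ℝ} (hA : A.IsSymm) (hD : D.IsSymm) {b : ℝ}
    (hb : 0 < b) (hDb : ∀ v : n → ℝ, (D *ᵥ v) ⬝ᵥ (D *ᵥ v) ≤ b ^ 2 * (v ⬝ᵥ v)) (K : ℕ) {s : ℝ}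
    (hs : 0 ≤ s) :
    traceCosh K (A + s • D) ≤ traceCosh K A * Real.cosh (b * s)
      + trace (D * taylorSinh K A) / b * Real.sinh (b * s) := by
  have h := le_cosh_add_sinh_of_deriv_le hb (hasDerivAt_traceCosh A D K)
    (exists_hasDerivAt_trace_mul_taylorSinh_le hA hD hDb K) hs
  simpa using h

end Deterministic

lemma specNorm_le_of_dotProduct_mulVec_self_le {d : ℕ} {A : Matrix (Fin d) (Fin d) ℝ} {c : ℝ}
    (hc : 0 ≤ c) (h : ∀ v : Fin d → ℝ, (A *ᵥ v) ⬝ᵥ (A *ᵥ v) ≤ c ^ 2 * (v ⬝ᵥ v)) :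
    specNorm A ≤ c := by
  refine ContinuousLinearMap.opNorm_le_bound _ hc fun v => ?_
  refine le_of_sq_le_sq ?_ (by positivity)
  have := h v.ofLp
  simpa [mul_pow, EuclideanSpace.norm_sq_eq, dotProduct, ← sq] using this

lemma pow_specNorm_le_trace {d : ℕ} [NeZero d] {A : Matrix (Fin d) (Fin d) ℝ}
    (hA : A.IsSymm) (k : ℕ) :
    specNorm A ^ (2 * k) ≤ trace (A ^ (2 * k)) := by
  obtain ⟨U, l, hU, hU', rfl, -⟩ := hA.exists_orthogonal_diagonalization
  obtain ⟨i, hi⟩ := Finite.exists_max fun i => |l i|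
  have h1 := specNorm_le_of_dotProduct_mulVec_self_le (abs_nonneg (l i))
    (dotProduct_mulVec_self_le_of_eigenvalues hU hU' hi)
  rw [orthogonal_conj_pow hU hU', trace_orthogonal_conj_diagonal hU]
  calc _ ≤ |l i| ^ (2 * k) := pow_le_pow_left₀ (norm_nonneg _) h1 _
    _ = l i ^ (2 * k) := (even_two_mul k).pow_abs _
    _ ≤ _ := Finset.single_le_sum (f := fun i => (l ^ (2 * k)) i)
      (fun i _ => (even_two_mul k).pow_nonneg _) (Finset.mem_univ i)

lemma sum_range_pow_div_factorial_le_traceCosh {d : ℕ} [NeZero d] {A : Matrix (Fin d) (Fin d) ℝ}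
    (hA : A.IsSymm) {x θ : ℝ} (hx : 0 ≤ x) (hxA : x ≤ specNorm A) (K : ℕ) :
    ∑ k ∈ Finset.range K, (θ * x) ^ (2 * k) / (2 * k).factorial ≤ traceCosh K (θ • A) := by
  refine Finset.sum_le_sum fun k _ => div_le_div_of_nonneg_right ?_ (Nat.cast_nonneg _)
  rw [smul_pow, trace_smul, smul_eq_mul, mul_pow]
  exact mul_le_mul_of_nonneg_left ((pow_le_pow_left₀ hx hxA _).trans (pow_specNorm_le_trace hA k))
    ((even_two_mul k).pow_nonneg _)

section Probability

open scoped ENNReal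

variable {Ω : Type*} {m m0 : MeasurableSpace Ω} {μ : Measure Ω}
  {n : Type*} [Fintype n] [DecidableEq n]

lemma stronglyMeasurable_matrix_pow {A : Ω → Matrix n n ℝ}
    (hA : ∀ i j, StronglyMeasurable[m] fun ω => A ω i j) (k : ℕ) (i j : n) :
    StronglyMeasurable[m] fun ω => (A ω ^ k) i j := by
  induction k generalizing i j with
  | zero => simpa using stronglyMeasurable_const
  | succ k ih =>
    simp only [pow_succ, Matrix.mul_apply]
    exact Finset.stronglyMeasurable_fun_sum _ fun l _ => (ih i l).mul (hA l j)

lemma memLp_top_matrix_pow [IsFiniteMeasure μ] {A : Ω → Matrix n n ℝ}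
    (hA : ∀ i j, MemLp (fun ω => A ω i j) ∞ μ) (k : ℕ) (i j : n) :
    MemLp (fun ω => (A ω ^ k) i j) ∞ μ := by
  induction k generalizing i j with
  | zero => simpa using memLp_const _
  | succ k ih =>
    simp only [pow_succ, Matrix.mul_apply]
    exact memLp_finsetSum _ fun l _ => (hA l j).mul (ih i l)

lemma integrable_traceCosh [IsFiniteMeasure μ] {A : Ω → Matrix n n ℝ}
    (hA : ∀ i j, MemLp (fun ω => A ω i j) ∞ μ) (K : ℕ) :
    Integrable (fun ω => traceCosh K (A ω)) μ := by
  simp only [traceCosh, trace, diag_apply]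
  exact integrable_finsetSum _ fun k _ => (integrable_finsetSum _ fun i _ =>
    (memLp_top_matrix_pow hA _ i i).integrable le_top).div_const _

lemma stronglyMeasurable_taylorSinh {A : Ω → Matrix n n ℝ}
    (hA : ∀ i j, StronglyMeasurable[m] fun ω => A ω i j) (K : ℕ) (i j : n) :
    StronglyMeasurable[m] fun ω => taylorSinh K (A ω) i j := by
  simp only [taylorSinh, Matrix.sum_apply, Matrix.smul_apply]
  exact Finset.stronglyMeasurable_fun_sum _ fun k _ =>
    (stronglyMeasurable_matrix_pow hA (2 * k - 1) i j).const_smul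
      ((2 * k : ℕ) / (2 * k).factorial : ℝ)

lemma memLp_top_taylorSinh [IsFiniteMeasure μ] {A : Ω → Matrix n n ℝ}
    (hA : ∀ i j, MemLp (fun ω => A ω i j) ∞ μ) (K : ℕ) (i j : n) :
    MemLp (fun ω => taylorSinh K (A ω) i j) ∞ μ := by
  simp only [taylorSinh, Matrix.sum_apply, Matrix.smul_apply]
  exact memLp_finsetSum _ fun k _ =>
    (memLp_top_matrix_pow hA (2 * k - 1) i j).const_smul
      ((2 * k : ℕ) / (2 * k).factorial : ℝ)

lemma integral_sub_condExp_mul_eq_zero [IsFiniteMeasure μ] (hm : m ≤ m0) {X G : Ω → ℝ}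
    (hX : Integrable X μ) (hG : StronglyMeasurable[m] G) (hGb : MemLp G ∞ μ) :
    ∫ ω, (X ω - (μ[X | m]) ω) * G ω ∂μ = 0 := by
  have h1 : Integrable (X * G) μ := hX.mul_of_top_left hGb
  have h2 : Integrable (μ[X | m] * G) μ := integrable_condExp.mul_of_top_left hGb
  have h3 : ∫ ω, (X * G) ω ∂μ = ∫ ω, (μ[X | m] * G) ω ∂μ := by
    rw [← integral_condExp hm]
    exact integral_congr_ae (condExp_mul_of_stronglyMeasurable_right hG h1 hX)
  simp only [sub_mul]
  exact (integral_sub h1 h2).trans (sub_eq_zero.2 h3)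

lemma integral_traceCosh_add_smul_le [IsFiniteMeasure μ] (hm : m ≤ m0)
    {A X D : Ω → Matrix n n ℝ} (hAm : ∀ i j, StronglyMeasurable[m] fun ω => A ω i j)
    (hA : ∀ i j, MemLp (fun ω => A ω i j) ∞ μ) (hAs : ∀ᵐ ω ∂μ, (A ω).IsSymm)
    (hX : ∀ i j, Integrable (fun ω => X ω i j) μ)
    (hDX : ∀ ω i j, D ω i j = X ω i j - (μ[fun ω' => X ω' i j | m]) ω)
    (hD : ∀ i j, MemLp (fun ω => D ω i j) ∞ μ) (hDs : ∀ᵐ ω ∂μ, (D ω).IsSymm) {b : ℝ} (hb : 0 < b)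
    (hDb : ∀ᵐ ω ∂μ, ∀ v : n → ℝ, (D ω *ᵥ v) ⬝ᵥ (D ω *ᵥ v) ≤ b ^ 2 * (v ⬝ᵥ v))
    (K : ℕ) {s : ℝ} (hs : 0 ≤ s) :
    ∫ ω, traceCosh K (A ω + s • D ω) ∂μ ≤ (∫ ω, traceCosh K (A ω) ∂μ) * Real.cosh (b * s) := by
  have hG : ∀ i j, ∫ ω, D ω i j * taylorSinh K (A ω) j i ∂μ = 0 := fun i j => by
    simp only [hDX]
    exact integral_sub_condExp_mul_eq_zero hm (hX i j) (stronglyMeasurable_taylorSinh hAm K j i)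
      (memLp_top_taylorSinh hA K j i)
  have hint : ∀ i j, Integrable (fun ω => D ω i j * taylorSinh K (A ω) j i) μ := fun i j =>
    ((hD i j).integrable le_top).mul_of_top_left (memLp_top_taylorSinh hA K j i)
  have htr : ∀ ω, trace (D ω * taylorSinh K (A ω))
      = ∑ i, ∑ j, D ω i j * taylorSinh K (A ω) j i := fun ω => by
    simp only [trace, diag_apply, Matrix.mul_apply]
  have hTint : Integrable (fun ω => trace (D ω * taylorSinh K (A ω))) μ := by
    simp only [htr]
    exact integrable_finsetSum _ fun i _ => integrable_finsetSum _ fun j _ => hint i j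
  have hT : ∫ ω, trace (D ω * taylorSinh K (A ω)) ∂μ = 0 := by
    simp only [htr]
    rw [integral_finsetSum _ fun i _ => integrable_finsetSum _ fun j _ => hint i j]
    refine Finset.sum_eq_zero fun i _ => ?_
    rw [integral_finsetSum _ fun j _ => hint i j]
    exact Finset.sum_eq_zero fun j _ => hG i j
  have hAint := integrable_traceCosh hA K
  have hADint : Integrable (fun ω => traceCosh K (A ω + s • D ω)) μ :=
    integrable_traceCosh (fun i j => (hA i j).add ((hD i j).const_smul s)) K
  have h1 := hAint.mul_const (Real.cosh (b * s))
  have h2 := (hTint.div_const b).mul_const (Real.sinh (b * s))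
  calc ∫ ω, traceCosh K (A ω + s • D ω) ∂μ
      ≤ ∫ ω, (traceCosh K (A ω) * Real.cosh (b * s)
        + trace (D ω * taylorSinh K (A ω)) / b * Real.sinh (b * s)) ∂μ := by
        refine integral_mono_ae hADint (h1.add h2) ?_
        filter_upwards [hAs, hDs, hDb] with ω hω1 hω2 hω3
        exact traceCosh_add_smul_le hω1 hω2 hb hω3 K hs
    _ = _ := by
        rw [integral_add h1 h2, integral_mul_const, integral_mul_const, integral_div, hT]
        simp

end Probability

lemma traceCosh_zero_le {n : Type*} [Fintype n] [DecidableEq n] (K : ℕ) :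
    traceCosh K (0 : Matrix n n ℝ) ≤ Fintype.card n := by
  cases K with
  | zero => simp [traceCosh]
  | succ K => simp [traceCosh, Finset.sum_range_succ']

lemma dotProduct_mulVec_self_le_of_forall_eigenvalue {n : Type*} [Fintype n] [DecidableEq n]
    {A : Matrix n n ℝ} (hA : A.IsSymm) {b : ℝ}
    (h : ∀ (c : ℝ) (v : n → ℝ), v ≠ 0 → A *ᵥ v = c • v → c ∈ Set.Icc (-b) b) (v : n → ℝ) :
    (A *ᵥ v) ⬝ᵥ (A *ᵥ v) ≤ b ^ 2 * (v ⬝ᵥ v) := by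
  obtain ⟨U, l, hU, hU', hAU, hl⟩ := hA.exists_orthogonal_diagonalization
  rw [hAU]
  refine dotProduct_mulVec_self_le_of_eigenvalues hU hU' (fun i => ?_) v
  obtain ⟨w, hw, hw'⟩ := hl i
  exact abs_le.2 (h _ w hw hw')

lemma abs_apply_le_of_dotProduct_mulVec_self_le {n : Type*} [Fintype n] [DecidableEq n]
    {A : Matrix n n ℝ} {b : ℝ} (hb : 0 ≤ b)
    (h : ∀ v : n → ℝ, (A *ᵥ v) ⬝ᵥ (A *ᵥ v) ≤ b ^ 2 * (v ⬝ᵥ v)) (i j : n) : |A i j| ≤ b := by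
  have h1 := h (Pi.single j 1)
  rw [mulVec_single_one, dotProduct_single_one, Pi.single_eq_same, mul_one] at h1
  refine abs_le_of_sq_le_sq ?_ hb
  refine le_trans ?_ h1
  rw [sq]
  exact Finset.single_le_sum (f := fun i => A i j * A i j) (fun i _ => mul_self_nonneg _)
    (Finset.mem_univ i)

/-- matrix Hoeffding inequality for martingales.
Let `(M τ)_{τ=1}^t` be an adapted, integrable, almost surely symmetric matrix-valued
process.  If all eigenvalues of the martingale difference
`D τ = M τ − 𝔼[M τ | ℱ (τ−1)]` lie in `[-b, b]` almost surely, then for every `x > 0`,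
`ℙ(‖∑_{τ=1}^t D τ‖₂ ≥ x) ≤ 2 d exp(−x² / (2 t b²))`. -/
theorem matrix_hoeffding_martingale
    {Ω : Type*} {m0 : MeasurableSpace Ω} (μ : Measure Ω) [IsProbabilityMeasure μ]
    (d t : ℕ) (ℱ : Filtration ℕ m0)
    (M : ℕ → Ω → Matrix (Fin d) (Fin d) ℝ)
    (hadapt : ∀ τ ∈ Finset.Icc 1 t, ∀ i j, StronglyMeasurable[ℱ τ] fun ω => M τ ω i j)
    (hint : ∀ τ ∈ Finset.Icc 1 t, ∀ i j, Integrable (fun ω => M τ ω i j) μ)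
    (hsymm : ∀ τ ∈ Finset.Icc 1 t, ∀ᵐ ω ∂μ, (M τ ω).IsSymm)
    (b : ℝ) (hb : 0 < b)
    (D : ℕ → Ω → Matrix (Fin d) (Fin d) ℝ)
    (hD : ∀ τ ω i j, D τ ω i j = M τ ω i j - (μ[fun ω' => M τ ω' i j | ℱ (τ - 1)]) ω)
    (heig : ∀ τ ∈ Finset.Icc 1 t, ∀ᵐ ω ∂μ, ∀ (c : ℝ) (v : Fin d → ℝ),
      v ≠ 0 → (D τ ω) *ᵥ v = c • v → c ∈ Set.Icc (-b) b)
    (x : ℝ) (hx : 0 < x) :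
    μ {ω | x ≤ specNorm (∑ τ ∈ Finset.Icc 1 t, D τ ω)} ≤
      ENNReal.ofReal (2 * d * Real.exp (-x ^ 2 / (2 * t * b ^ 2))) := by
  have hzero : ∀ s : Set Ω, (∀ ω, ω ∉ s) → μ s ≤
      ENNReal.ofReal (2 * d * Real.exp (-x ^ 2 / (2 * t * b ^ 2))) := fun s hs => by
    rw [Set.eq_empty_of_forall_notMem hs, measure_empty]; exact zero_le
  rcases Nat.eq_zero_or_pos t with rfl | ht
  · refine hzero _ fun ω hω => ?_
    simp only [specNorm, Finset.Icc_eq_empty_of_lt Nat.zero_lt_one, Finset.sum_empty, map_zero,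
      norm_zero, Set.mem_ofPred_eq] at hω
    exact hx.not_ge hω
  rcases Nat.eq_zero_or_pos d with rfl | hd
  · refine hzero _ fun ω hω => ?_
    rw [Set.mem_ofPred_eq, specNorm, Subsingleton.elim (∑ τ ∈ Finset.Icc 1 t, D τ ω) 0, map_zero,
      norm_zero] at hω
    exact hx.not_ge hω
  have : NeZero d := ⟨hd.ne'⟩
  have hDmeas : ∀ τ ∈ Finset.Icc 1 t, ∀ i j, StronglyMeasurable[ℱ τ] fun ω => D τ ω i j := by
    intro τ hτ i j
    simp only [hD]
    exact (hadapt τ hτ i j).sub (stronglyMeasurable_condExp.mono (ℱ.mono (Nat.sub_le _ _)))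
  have hDsymm : ∀ τ ∈ Finset.Icc 1 t, ∀ᵐ ω ∂μ, (D τ ω).IsSymm := by
    intro τ hτ
    have h : ∀ᵐ ω ∂μ, ∀ i j, (μ[fun ω' => M τ ω' i j | ℱ (τ - 1)]) ω
        = (μ[fun ω' => M τ ω' j i | ℱ (τ - 1)]) ω := by
      refine ae_all_iff.2 fun i => ae_all_iff.2 fun j => condExp_congr_ae ?_
      filter_upwards [hsymm τ hτ] with ω hω using hω.apply j i
    filter_upwards [h, hsymm τ hτ] with ω hω hω'
    refine Matrix.IsSymm.ext fun i j => ?_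
    rw [hD, hD, hω j i, hω'.apply i j]
  have hDb : ∀ τ ∈ Finset.Icc 1 t, ∀ᵐ ω ∂μ, ∀ v : Fin d → ℝ,
      (D τ ω *ᵥ v) ⬝ᵥ (D τ ω *ᵥ v) ≤ b ^ 2 * (v ⬝ᵥ v) := by
    intro τ hτ
    filter_upwards [hDsymm τ hτ, heig τ hτ] with ω hω hω'
    exact dotProduct_mulVec_self_le_of_forall_eigenvalue hω hω'
  have hDtop : ∀ τ ∈ Finset.Icc 1 t, ∀ i j, MemLp (fun ω => D τ ω i j) ⊤ μ := by
    intro τ hτ i j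
    refine memLp_top_of_bound ((hDmeas τ hτ i j).mono (ℱ.le τ)).aestronglyMeasurable b ?_
    filter_upwards [hDb τ hτ] with ω hω
    exact abs_apply_le_of_dotProduct_mulVec_self_le hb.le hω i j
  set S : ℕ → Ω → Matrix (Fin d) (Fin d) ℝ := fun r ω => ∑ τ ∈ Finset.Icc 1 r, D τ ω with hS
  have hsub : ∀ r ≤ t, ∀ τ ∈ Finset.Icc 1 r, τ ∈ Finset.Icc 1 t := fun r hr τ hτ =>
    Finset.Icc_subset_Icc_right hr hτ
  have hSsymm : ∀ r ≤ t, ∀ᵐ ω ∂μ, (S r ω).IsSymm := by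
    intro r hr
    have h : ∀ᵐ ω ∂μ, ∀ τ ∈ Finset.Icc 1 r, (D τ ω).IsSymm :=
      (Finset.eventually_all _).2 fun τ hτ => hDsymm τ (hsub r hr τ hτ)
    filter_upwards [h] with ω hω
    rw [Matrix.IsSymm, hS, transpose_sum]
    exact Finset.sum_congr rfl hω
  have hSmeas : ∀ r ≤ t, ∀ i j, StronglyMeasurable[ℱ r] fun ω => S r ω i j := by
    intro r hr i j
    simp only [hS, Matrix.sum_apply]
    exact Finset.stronglyMeasurable_fun_sum _ fun τ hτ =>
      (hDmeas τ (hsub r hr τ hτ) i j).mono (ℱ.mono (Finset.mem_Icc.1 hτ).2)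
  have hStop : ∀ r ≤ t, ∀ i j, MemLp (fun ω => S r ω i j) ⊤ μ := by
    intro r hr i j
    simp only [hS, Matrix.sum_apply]
    exact memLp_finsetSum _ fun τ hτ => hDtop τ (hsub r hr τ hτ) i j
  have ht' : (0 : ℝ) < t := Nat.cast_pos.2 ht
  set θ : ℝ := x / (t * b ^ 2) with hθ
  have hθ0 : 0 ≤ θ := by positivity
  have hmoment : ∀ K, ∀ r ≤ t,
      ∫ ω, traceCosh K (θ • S r ω) ∂μ ≤ d * Real.cosh (b * θ) ^ r := by
    intro K r
    induction r with
    | zero =>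
      intro _
      simpa [hS] using traceCosh_zero_le (n := Fin d) K
    | succ r ih =>
      intro hr
      have hmem : r + 1 ∈ Finset.Icc 1 t := Finset.mem_Icc.2 ⟨by omega, hr⟩
      have hr' : r ≤ t := by omega
      have hSr : ∀ ω, θ • S (r + 1) ω = θ • S r ω + θ • D (r + 1) ω := fun ω => by
        simp only [hS]
        rw [Finset.sum_Icc_succ_top (by omega), smul_add]
      simp only [hSr]
      have h := integral_traceCosh_add_smul_le (ℱ.le r) (A := fun ω => θ • S r ω)
        (X := M (r + 1)) (D := D (r + 1))
        (fun i j => (hSmeas r hr' i j).const_smul θ) (fun i j => (hStop r hr' i j).const_smul θ)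
        ((hSsymm r hr').mono fun ω hω => hω.smul θ) (hint _ hmem) (hD (r + 1)) (hDtop _ hmem)
        (hDsymm _ hmem) hb (hDb _ hmem) K hθ0
      refine h.trans ?_
      rw [pow_succ, ← mul_assoc]
      exact mul_le_mul_of_nonneg_right (ih hr') (Real.cosh_pos _).le
  set E : Set Ω := {ω | x ≤ specNorm (S t ω)} with hE
  have hmarkov : ∀ K, (∑ k ∈ Finset.range K, (θ * x) ^ (2 * k) / (2 * k).factorial) * μ.real E
      ≤ d * Real.cosh (b * θ) ^ t := by
    intro K
    set c := ∑ k ∈ Finset.range K, (θ * x) ^ (2 * k) / ((2 * k).factorial : ℝ) with hc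
    have hc0 : 0 ≤ c := Finset.sum_nonneg fun k _ => by positivity
    have hnn : 0 ≤ᵐ[μ] fun ω => traceCosh K (θ • S t ω) := by
      filter_upwards [hSsymm t le_rfl] with ω hω using traceCosh_nonneg (hω.smul θ) K
    have h1 := mul_meas_ge_le_integral_of_nonneg hnn
      (integrable_traceCosh (fun i j => (hStop t le_rfl i j).const_smul θ) K) c
    have h2 : μ E ≤ μ {ω | c ≤ traceCosh K (θ • S t ω)} := by
      refine measure_mono_ae ?_
      filter_upwards [hSsymm t le_rfl] with ω hω hωE
      exact sum_range_pow_div_factorial_le_traceCosh hω hx.le hωE K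
    have h3 : μ.real E ≤ μ.real {ω | c ≤ traceCosh K (θ • S t ω)} :=
      ENNReal.toReal_mono (measure_ne_top _ _) h2
    exact (mul_le_mul_of_nonneg_left h3 hc0).trans (h1.trans (hmoment K t le_rfl))
  have hcosh : Real.cosh (θ * x) * μ.real E ≤ d * Real.cosh (b * θ) ^ t :=
    le_of_tendsto' ((Real.hasSum_cosh (θ * x)).tendsto_sum_nat.mul_const _) hmarkov
  have hupper : Real.cosh (b * θ) ^ t ≤ Real.exp (t * ((b * θ) ^ 2 / 2)) := by
    rw [Real.exp_nat_mul]
    exact pow_le_pow_left₀ (Real.cosh_pos _).le (Real.cosh_le_exp_half_sq _) _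
  have hlower : Real.exp (θ * x) ≤ 2 * Real.cosh (θ * x) := by
    rw [Real.cosh_eq]
    linarith [Real.exp_pos (-(θ * x))]
  have hexp : Real.exp (-x ^ 2 / (2 * t * b ^ 2))
      = Real.exp (t * ((b * θ) ^ 2 / 2)) / Real.exp (θ * x) := by
    rw [← Real.exp_sub]
    congr 1
    rw [hθ]
    field_simp
    ring
  have hreal : μ.real E ≤ 2 * d * Real.exp (-x ^ 2 / (2 * t * b ^ 2)) := by
    rw [hexp, ← mul_div_assoc, le_div_iff₀ (Real.exp_pos _)]
    have h1 := mul_le_mul_of_nonneg_left hlower (measureReal_nonneg (μ := μ) (s := E))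
    have h2 := mul_le_mul_of_nonneg_left hupper (Nat.cast_nonneg (α := ℝ) d)
    linarith
  exact (ofReal_measureReal (μ := μ) (s := E)).symm.le.trans (ENNReal.ofReal_le_ofReal hreal)
end

section
/- Threshold for a logarithmic inequality: for all real numbers a > 1/2, b > e², and t with t ≥ 4a·(1 + log(2a√b / e)), it holds that t ≥ a·log(b t²). -/
/-- threshold for a logarithmic inequality.
For reals `a > 1/2`, `b > e²`, if `t ≥ 4a(1 + log(2a√b / e))`, then `t ≥ a log(b t²)`. -/
theorem log_threshold (a b t : ℝ) (ha : 1 / 2 < a) (hb : Real.exp 2 < b)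
    (ht : 4 * a * (1 + Real.log (2 * a * Real.sqrt b / Real.exp 1)) ≤ t) :
    a * Real.log (b * t ^ 2) ≤ t := by
  have ha0 : 0 < a := by linarith
  have hb0 : 0 < b := (Real.exp_pos 2).trans hb
  have hlogb : 2 < Real.log b := (Real.lt_log_iff_exp_lt hb0).2 hb
  have hlog2a : 0 < Real.log (2 * a) := Real.log_pos (by linarith)
  rw [Real.log_div (by positivity) (Real.exp_ne_zero 1), Real.log_exp,
    Real.log_mul (by positivity) (by positivity), Real.log_sqrt hb0.le] at ht
  have ht0 : 0 < t := lt_of_lt_of_le (mul_pos (by positivity) (by linarith)) ht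
  have hs : 2 * (Real.log (2 * a) + Real.log b / 2) ≤ t / (2 * a) := by
    rw [le_div_iff₀ (by positivity)]
    linarith
  have hlogt : Real.log t ≤ Real.log (2 * a) + t / (2 * a) / 2 := by
    have h := Real.log_le_sub_one_of_pos (show 0 < t / (2 * a) / 2 by positivity)
    rw [Real.log_div (by positivity) (by norm_num), Real.log_div ht0.ne' (by positivity)] at h
    linarith [Real.log_two_lt_d9]
  rw [Real.log_mul hb0.ne' (by positivity), Real.log_pow, Nat.cast_ofNat]
  calc a * (Real.log b + 2 * Real.log t) ≤ a * (2 * (t / (2 * a))) := by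
        gcongr
        linarith
    _ = t := by field_simp
end

section
/- Domination preserves sub-Gaussianity up to a factor 2: let X and Y be real random variables on a probability space with 𝔼[X] = 0 and |X| ≤ |Y| almost surely. If Y is σ-sub-Gaussian in the moment-generating-function sense, i.e., 𝔼[exp(λY)] ≤ exp(λ²σ²/2) for all λ ∈ ℝ, then X is 2σ-sub-Gaussian: 𝔼[exp(λX)] ≤ exp(λ²(2σ)²/2) = exp(2λ²σ²) for all λ ∈ ℝ (in particular exp(λX) is integrable for every λ). -/
open MeasureTheory

theorem Real.exp_le_add_cosh_two_mul (x : ℝ) : Real.exp x ≤ x + Real.cosh (2 * x) := by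
  have h₁ := Real.add_one_le_exp (-x)
  have h₂ := Real.one_le_cosh x
  have h₃ := Real.cosh_eq x
  have h₄ := Real.cosh_sq x
  rw [Real.cosh_two_mul]
  nlinarith

/-- domination preserves sub-Gaussianity up to a factor 2.
If `𝔼[X] = 0`, `|X| ≤ |Y|` almost surely, and `Y` is `σ`-sub-Gaussian
(`𝔼[exp(λY)] ≤ exp(λ²σ²/2)` for all `λ`), then `X` is `2σ`-sub-Gaussian:
`exp(λX)` is integrable and `𝔼[exp(λX)] ≤ exp(2λ²σ²)` for all `λ`. -/
theorem subGaussian_of_dominated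
    {Ω : Type*} [MeasurableSpace Ω] (μ : Measure Ω) [IsProbabilityMeasure μ]
    (X Y : Ω → ℝ) (σ : ℝ) (hσ : 0 < σ)
    (hXm : Measurable X) (hYm : Measurable Y)
    (hXint : Integrable X μ) (hX0 : ∫ ω, X ω ∂μ = 0)
    (hXY : ∀ᵐ ω ∂μ, |X ω| ≤ |Y ω|)
    (hY : ∀ l : ℝ, Integrable (fun ω => Real.exp (l * Y ω)) μ ∧
      ∫ ω, Real.exp (l * Y ω) ∂μ ≤ Real.exp (l ^ 2 * σ ^ 2 / 2)) :
    ∀ l : ℝ, Integrable (fun ω => Real.exp (l * X ω)) μ ∧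
      ∫ ω, Real.exp (l * X ω) ∂μ ≤ Real.exp (l ^ 2 * (2 * σ) ^ 2 / 2) := by
  intro l
  have exp_le : ∀ᵐ ω ∂μ, Real.exp (l * X ω) ≤
      Real.exp (l * Y ω) + Real.exp (-l * Y ω) := by
    filter_upwards [hXY] with ω h
    have habs : l * X ω ≤ |l * Y ω| := by
      refine (le_abs_self _).trans ?_
      rw [abs_mul, abs_mul]
      gcongr
    rcases abs_cases (l * Y ω) with ⟨h', -⟩ | ⟨h', -⟩ <;> rw [h'] at habs
    · linarith [Real.exp_le_exp.2 habs, Real.exp_pos (-l * Y ω)]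
    · rw [← neg_mul] at habs
      linarith [Real.exp_le_exp.2 habs, Real.exp_pos (l * Y ω)]
  have integrable_exp : Integrable (fun ω => Real.exp (l * X ω)) μ := by
    refine ((hY l).1.add (hY (-l)).1).mono' (by fun_prop) ?_
    filter_upwards [exp_le] with ω h
    simpa [abs_of_pos (Real.exp_pos _)] using h
  refine ⟨integrable_exp, ?_⟩
  have le_cosh : ∀ᵐ ω ∂μ, Real.exp (l * X ω) ≤ l * X ω +
      (Real.exp (2 * l * Y ω) + Real.exp (-(2 * l) * Y ω)) / 2 := by
    filter_upwards [hXY] with ω h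
    have hcosh : Real.cosh (2 * (l * X ω)) ≤ Real.cosh (2 * l * Y ω) := by
      rw [Real.cosh_le_cosh, ← mul_assoc, abs_mul, abs_mul _ (Y ω)]
      gcongr
    rw [Real.cosh_eq (2 * l * Y ω), ← neg_mul] at hcosh
    linarith [Real.exp_le_add_cosh_two_mul (l * X ω)]
  have hsum : Integrable
      (fun ω => Real.exp (2 * l * Y ω) + Real.exp (-(2 * l) * Y ω)) μ :=
    (hY (2 * l)).1.add (hY (-(2 * l))).1
  calc ∫ ω, Real.exp (l * X ω) ∂μ
      ≤ ∫ ω, (l * X ω + (Real.exp (2 * l * Y ω) + Real.exp (-(2 * l) * Y ω)) / 2) ∂μ :=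
        integral_mono_ae integrable_exp
          ((hXint.const_mul l).add (hsum.div_const 2)) le_cosh
    _ = (∫ ω, Real.exp (2 * l * Y ω) ∂μ + ∫ ω, Real.exp (-(2 * l) * Y ω) ∂μ) / 2 := by
        rw [integral_add (hXint.const_mul l) (hsum.div_const 2), integral_const_mul, hX0,
          integral_div, integral_add (hY (2 * l)).1 (hY (-(2 * l))).1]
        ring
    _ ≤ Real.exp (l ^ 2 * (2 * σ) ^ 2 / 2) := by
        have h₁ := (hY (2 * l)).2
        have h₂ := (hY (-(2 * l))).2
        rw [neg_sq] at h₂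
        rw [show l ^ 2 * (2 * σ) ^ 2 / 2 = (2 * l) ^ 2 * σ ^ 2 / 2 by ring]
        linarith
end

section
/- Dimension-free self-normalized bound for vector-valued martingales (improved constant 4): let (Ω, 𝔉, ℙ) be a probability space with filtration (𝔉_s)_{s=0}^{t}. Let (X_s)_{s=1}^{t} be random vectors in ℝ^d with each X_s measurable with respect to 𝔉_0, and let (η_s)_{s=1}^{t} be real random variables such that η_s is 𝔉_s-measurable and is conditionally σ-sub-Gaussian given 𝔉_{s−1}: for all λ ∈ ℝ, 𝔼[exp(λ η_s) | 𝔉_{s−1}] ≤ exp(λ²σ²/2) almost surely. Then for every δ ∈ (0,1), with probability at least 1 − δ, ‖ Σ_{s=1}^{t} η_s X_s ‖₂ ≤ 4σ · √( Σ_{s=1}^{t} ‖X_s‖₂² ) · √( 2 log(4t²/δ) ). -/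
open MeasureTheory

open ProbabilityTheory Filter Topology
open scoped ENNReal

lemma lintegral_exp_quadratic {a : ℝ} (ha : 0 < a) (b e : ℝ) :
    ∫⁻ x : ℝ, ENNReal.ofReal (Real.exp (-a * x ^ 2 + b * x + e)) =
      ENNReal.ofReal (√(Real.pi / a) * Real.exp (b ^ 2 / (4 * a) + e)) := by
  have h : ∀ x : ℝ, Real.exp (-a * x ^ 2 + b * x + e) =
      Real.exp (-a * (x + -(b / (2 * a))) ^ 2) * Real.exp (b ^ 2 / (4 * a) + e) := by
    intro x
    rw [← Real.exp_add]
    congr 1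
    field_simp
    ring
  simp_rw [h, ENNReal.ofReal_mul (Real.exp_pos _).le]
  rw [lintegral_mul_const _ (by fun_prop),
    lintegral_add_right_eq_self (fun x : ℝ => ENNReal.ofReal (Real.exp (-a * x ^ 2))),
    ← ofReal_integral_eq_lintegral_ofReal (integrable_exp_neg_mul_sq ha)
      (ae_of_all _ fun x => (Real.exp_pos _).le), integral_gaussian,
    ENNReal.ofReal_mul (Real.sqrt_nonneg _)]

/-- Extended-real form of `σ`-sub-Gaussianity of a measure on the line. -/
def SubGaussianLaw (σ : ℝ) (ν : Measure ℝ) : Prop :=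
  ∀ c : ℝ, ∫⁻ y, ENNReal.ofReal (Real.exp (c * y)) ∂ν ≤
    ENNReal.ofReal (Real.exp (c ^ 2 * σ ^ 2 / 2))

lemma SubGaussianLaw.of_rat {σ : ℝ} {ν : Measure ℝ}
    (h : ∀ q : ℚ, ∫⁻ y, ENNReal.ofReal (Real.exp ((q : ℝ) * y)) ∂ν ≤
      ENNReal.ofReal (Real.exp ((q : ℝ) ^ 2 * σ ^ 2 / 2))) : SubGaussianLaw σ ν := by
  intro c
  obtain ⟨u, hu, hlim⟩ := mem_closure_iff_seq_limit.1 (Rat.denseRange_cast (𝕜 := ℝ) c)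
  choose q hq using hu
  have hpt : ∀ y, ENNReal.ofReal (Real.exp (c * y)) =
      liminf (fun n => ENNReal.ofReal (Real.exp (u n * y))) atTop := fun y =>
    (ENNReal.tendsto_ofReal ((Real.continuous_exp.tendsto _).comp
      (hlim.mul_const y))).liminf_eq.symm
  have hrhs : Tendsto (fun n => ENNReal.ofReal (Real.exp (u n ^ 2 * σ ^ 2 / 2))) atTop
      (𝓝 (ENNReal.ofReal (Real.exp (c ^ 2 * σ ^ 2 / 2)))) :=
    ENNReal.tendsto_ofReal ((Real.continuous_exp.tendsto _).comp
      (((hlim.pow 2).mul_const _).div_const _))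
  simp_rw [hpt]
  refine (lintegral_liminf_le fun n => by fun_prop).trans ?_
  rw [← hrhs.liminf_eq]
  refine liminf_le_liminf (Eventually.of_forall fun n => ?_)
  simp only [← hq n]
  exact h (q n)

lemma SubGaussianLaw.lintegral_exp_quadratic_le {σ : ℝ} {ν : Measure ℝ} [SFinite ν]
    (h : SubGaussianLaw σ ν) (β γ : ℝ) (hγ : σ ^ 2 * γ ^ 2 < 1) :
    ∫⁻ y, ENNReal.ofReal (Real.exp (β * y + γ ^ 2 * y ^ 2 / 2)) ∂ν ≤
      ENNReal.ofReal ((√(1 - σ ^ 2 * γ ^ 2))⁻¹ *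
        Real.exp (β ^ 2 * σ ^ 2 / (2 * (1 - σ ^ 2 * γ ^ 2)))) := by
  have hd : 0 < 1 - σ ^ 2 * γ ^ 2 := by linarith
  set K : ℝ := √(2 * Real.pi) with hK
  have hKpos : 0 < K := by positivity
  have hmul : ENNReal.ofReal K * ∫⁻ y, ENNReal.ofReal (Real.exp (β * y + γ ^ 2 * y ^ 2 / 2)) ∂ν ≤
      ENNReal.ofReal K * ENNReal.ofReal ((√(1 - σ ^ 2 * γ ^ 2))⁻¹ *
        Real.exp (β ^ 2 * σ ^ 2 / (2 * (1 - σ ^ 2 * γ ^ 2)))) := by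
    calc _ = ∫⁻ y, (∫⁻ x : ℝ, ENNReal.ofReal
            (Real.exp (-(1 / 2) * x ^ 2) * Real.exp ((β + γ * x) * y))) ∂ν := by
          rw [← lintegral_const_mul _ (by fun_prop)]
          refine lintegral_congr fun y => ?_
          rw [← ENNReal.ofReal_mul hKpos.le]
          have h1 : ∀ x : ℝ, Real.exp (-(1 / 2) * x ^ 2) * Real.exp ((β + γ * x) * y) =
              Real.exp (-(1 / 2) * x ^ 2 + (γ * y) * x + β * y) := by
            intro x; rw [← Real.exp_add]; congr 1; ring
          simp_rw [h1]
          rw [lintegral_exp_quadratic (by norm_num)]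
          congr 2
          · rw [hK]; congr 1; ring
          · congr 1; ring
      _ = ∫⁻ x : ℝ, ENNReal.ofReal (Real.exp (-(1 / 2) * x ^ 2)) *
            ∫⁻ y, ENNReal.ofReal (Real.exp ((β + γ * x) * y)) ∂ν := by
          rw [lintegral_lintegral_swap (by fun_prop)]
          refine lintegral_congr fun x => ?_
          rw [← lintegral_const_mul _ (by fun_prop)]
          exact lintegral_congr fun y => ENNReal.ofReal_mul (Real.exp_pos _).le
      _ ≤ ∫⁻ x : ℝ, ENNReal.ofReal (Real.exp (-(1 / 2) * x ^ 2)) *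
            ENNReal.ofReal (Real.exp ((β + γ * x) ^ 2 * σ ^ 2 / 2)) := by
          gcongr with x
          exact h _
      _ = _ := by
          have h1 : ∀ x : ℝ, ENNReal.ofReal (Real.exp (-(1 / 2) * x ^ 2)) *
              ENNReal.ofReal (Real.exp ((β + γ * x) ^ 2 * σ ^ 2 / 2)) =
              ENNReal.ofReal (Real.exp (-((1 - σ ^ 2 * γ ^ 2) / 2) * x ^ 2 +
                (β * γ * σ ^ 2) * x + β ^ 2 * σ ^ 2 / 2)) := by
            intro x
            rw [← ENNReal.ofReal_mul (Real.exp_pos _).le, ← Real.exp_add]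
            congr 2; ring
          simp_rw [h1]
          rw [lintegral_exp_quadratic (by linarith), ← ENNReal.ofReal_mul hKpos.le, ← mul_assoc,
            hK, ← Real.sqrt_inv, ← Real.sqrt_mul (by positivity)]
          congr 3
          · field_simp
          · rw [show (β * γ * σ ^ 2) ^ 2 = β ^ 2 * σ ^ 2 * (1 - (1 - σ ^ 2 * γ ^ 2)) by ring]
            generalize 1 - σ ^ 2 * γ ^ 2 = r at hd
            field_simp
            ring
  exact (ENNReal.mul_le_mul_iff_right (by simpa using hKpos) ENNReal.ofReal_ne_top).1 hmul

/-- The Gaussian mixture of the exponential supermartingales of a vector-valued martingale, as a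
function of the variance proxy `W` and of the squared norm `U` of the martingale. -/
noncomputable def gaussianMixture (σ W U : ℝ) : ℝ :=
  (√(1 + W))⁻¹ * Real.exp (U / (2 * σ ^ 2 * (1 + W)))

lemma SubGaussianLaw.lintegral_gaussianMixture_le {σ : ℝ} (hσ : 0 < σ) {ν : Measure ℝ} [SFinite ν]
    (h : SubGaussianLaw σ ν) {W w U p : ℝ} (hW : 0 ≤ W) (hw : 0 ≤ w) (hp : p ^ 2 ≤ U * w) :
    ∫⁻ y, ENNReal.ofReal (gaussianMixture σ (W + w) (U + 2 * y * p + y ^ 2 * w)) ∂ν ≤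
      ENNReal.ofReal (gaussianMixture σ W U) := by
  have hW1 : 0 < 1 + W := by linarith
  have hWw : 0 < 1 + (W + w) := by linarith
  set D : ℝ := σ ^ 2 * (1 + (W + w)) with hD
  have hDpos : 0 < D := by positivity
  have hγ : √(w / D) ^ 2 = w / D := Real.sq_sqrt (by positivity)
  have hσγ : 1 - σ ^ 2 * √(w / D) ^ 2 = (1 + W) / (1 + (W + w)) := by
    rw [hγ, hD]; field_simp; ring
  have hlt : σ ^ 2 * √(w / D) ^ 2 < 1 := by
    have : 0 < (1 + W) / (1 + (W + w)) := by positivity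
    linarith
  have hfac : ∀ y, gaussianMixture σ (W + w) (U + 2 * y * p + y ^ 2 * w) =
      ((√(1 + (W + w)))⁻¹ * Real.exp (U / (2 * D))) *
        Real.exp (p / D * y + √(w / D) ^ 2 * y ^ 2 / 2) := by
    intro y
    rw [gaussianMixture, mul_assoc (√_)⁻¹, ← Real.exp_add, hγ, hD]
    congr 2
    field_simp
    ring
  have hpos : 0 ≤ (√(1 + (W + w)))⁻¹ * Real.exp (U / (2 * D)) := by positivity
  simp_rw [hfac, ENNReal.ofReal_mul hpos]
  rw [lintegral_const_mul _ (by fun_prop)]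
  refine (mul_le_mul_right (h.lintegral_exp_quadratic_le (p / D) (√(w / D)) hlt) _).trans ?_
  rw [← ENNReal.ofReal_mul hpos, hσγ, gaussianMixture]
  refine ENNReal.ofReal_le_ofReal ?_
  have hsqrt : (√(1 + (W + w)))⁻¹ * (√((1 + W) / (1 + (W + w))))⁻¹ = (√(1 + W))⁻¹ := by
    rw [← mul_inv, ← Real.sqrt_mul hWw.le, mul_div_cancel₀ _ hWw.ne']
  rw [mul_mul_mul_comm, hsqrt, ← Real.exp_add]
  gcongr
  have e1 : U / (2 * σ ^ 2 * (1 + W)) - (U / (2 * D) +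
      (p / D) ^ 2 * σ ^ 2 / (2 * ((1 + W) / (1 + (W + w))))) =
      (U * w - p ^ 2) / (2 * σ ^ 2 * (1 + W) * (1 + (W + w))) := by
    rw [hD]; field_simp; ring
  have e2 : 0 ≤ (U * w - p ^ 2) / (2 * σ ^ 2 * (1 + W) * (1 + (W + w))) :=
    div_nonneg (by linarith) (by positivity)
  linarith

section Conditioning

variable {Ω β : Type*} {m0 : MeasurableSpace Ω} {mβ : MeasurableSpace β} {μ : Measure Ω}
  [IsProbabilityMeasure μ] {Y : Ω → β} {η : Ω → ℝ} {σ : ℝ}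

lemma lintegral_condDistrib_comp (hY : Measurable Y) (hη : Measurable η) {f : β × ℝ → ℝ≥0∞}
    (hf : Measurable f) :
    ∫⁻ b, ∫⁻ y, f (b, y) ∂condDistrib η Y μ b ∂(μ.map Y) = ∫⁻ ω, f (Y ω, η ω) ∂μ := by
  rw [← Measure.lintegral_compProd hf, compProd_map_condDistrib hη.aemeasurable,
    lintegral_map hf (hY.prodMk hη)]

lemma ae_subGaussianLaw_condDistrib (hY : Measurable Y) (hη : Measurable η)
    (hint : ∀ c : ℝ, Integrable (fun ω => Real.exp (c * η ω)) μ)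
    (hsub : ∀ c : ℝ, ∀ᵐ ω ∂μ, (μ[fun ω' => Real.exp (c * η ω') | mβ.comap Y]) ω ≤
      Real.exp (c ^ 2 * σ ^ 2 / 2)) :
    ∀ᵐ b ∂(μ.map Y), SubGaussianLaw σ (condDistrib η Y μ b) := by
  have : IsProbabilityMeasure (μ.map Y) := Measure.isProbabilityMeasure_map hY.aemeasurable
  have key : ∀ c : ℝ, ∀ᵐ b ∂(μ.map Y),
      ∫⁻ y, ENNReal.ofReal (Real.exp (c * y)) ∂condDistrib η Y μ b ≤
        ENNReal.ofReal (Real.exp (c ^ 2 * σ ^ 2 / 2)) := by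
    intro c
    have hmeas : Measurable fun y : ℝ => ENNReal.ofReal (Real.exp (c * y)) := by fun_prop
    refine ae_le_of_forall_setLIntegral_le_of_sigmaFinite hmeas.lintegral_kernel fun s hs _ => ?_
    have hsY : MeasurableSet[mβ.comap Y] (Y ⁻¹' s) := ⟨s, hs, rfl⟩
    have h1 := lintegral_condDistrib_comp (μ := μ) hY hη
      (f := (s ×ˢ Set.univ).indicator fun z => ENNReal.ofReal (Real.exp (c * z.2)))
      ((by fun_prop : Measurable fun z : β × ℝ => ENNReal.ofReal (Real.exp (c * z.2))).indicator
        (hs.prod MeasurableSet.univ))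
    have h2 : ∫⁻ b in s, ∫⁻ y, ENNReal.ofReal (Real.exp (c * y)) ∂condDistrib η Y μ b ∂(μ.map Y) =
        ∫⁻ ω in Y ⁻¹' s, ENNReal.ofReal (Real.exp (c * η ω)) ∂μ := by
      rw [← lintegral_indicator hs, ← lintegral_indicator (hY hs)]
      convert h1 using 1
      · refine lintegral_congr fun b => ?_
        by_cases hb : b ∈ s <;> simp [Set.indicator, hb]
      · refine lintegral_congr fun ω => ?_
        by_cases hb : Y ω ∈ s <;> simp [Set.indicator, hb]
    rw [h2, ← ofReal_integral_eq_lintegral_ofReal (hint c).integrableOn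
      (ae_of_all _ fun x => (Real.exp_pos _).le), ← setIntegral_condExp hY.comap_le (hint c) hsY]
    rw [setLIntegral_const, Measure.map_apply hY hs, ← ofReal_measureReal,
      ← ENNReal.ofReal_mul (Real.exp_pos _).le]
    refine ENNReal.ofReal_le_ofReal ?_
    refine (setIntegral_mono_ae integrable_condExp.integrableOn
      (integrable_const _).integrableOn (hsub c)).trans_eq ?_
    simp [mul_comm]
  filter_upwards [ae_all_iff.2 fun q : ℚ => key q] with b hb
  exact SubGaussianLaw.of_rat hb

lemma lintegral_comp_le_of_subGaussian (hY : Measurable Y) (hη : Measurable η)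
    (hint : ∀ c : ℝ, Integrable (fun ω => Real.exp (c * η ω)) μ)
    (hsub : ∀ c : ℝ, ∀ᵐ ω ∂μ, (μ[fun ω' => Real.exp (c * η ω') | mβ.comap Y]) ω ≤
      Real.exp (c ^ 2 * σ ^ 2 / 2))
    {f : β → ℝ → ℝ≥0∞} {g : β → ℝ≥0∞} (hf : Measurable (Function.uncurry f)) (hg : Measurable g)
    (hfg : ∀ (b : β) (ν : Measure ℝ) [SFinite ν], SubGaussianLaw σ ν → ∫⁻ y, f b y ∂ν ≤ g b) :
    ∫⁻ ω, f (Y ω) (η ω) ∂μ ≤ ∫⁻ ω, g (Y ω) ∂μ := by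
  rw [← lintegral_map hg hY]
  refine (lintegral_condDistrib_comp hY hη hf).symm.trans_le (lintegral_mono_ae ?_)
  filter_upwards [ae_subGaussianLaw_condDistrib hY hη hint hsub] with b hb
  exact hfg b _ hb

lemma lintegral_gaussianMixture_comp_le (hσ : 0 < σ) (hY : Measurable Y) (hη : Measurable η)
    (hint : ∀ c : ℝ, Integrable (fun ω => Real.exp (c * η ω)) μ)
    (hsub : ∀ c : ℝ, ∀ᵐ ω ∂μ, (μ[fun ω' => Real.exp (c * η ω') | mβ.comap Y]) ω ≤
      Real.exp (c ^ 2 * σ ^ 2 / 2))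
    {W w U p : β → ℝ} (hWm : Measurable W) (hwm : Measurable w) (hUm : Measurable U)
    (hpm : Measurable p) (hW : ∀ b, 0 ≤ W b) (hw : ∀ b, 0 ≤ w b)
    (hp : ∀ b, p b ^ 2 ≤ U b * w b) :
    ∫⁻ ω, ENNReal.ofReal (gaussianMixture σ (W (Y ω) + w (Y ω))
      (U (Y ω) + 2 * η ω * p (Y ω) + η ω ^ 2 * w (Y ω))) ∂μ ≤
      ∫⁻ ω, ENNReal.ofReal (gaussianMixture σ (W (Y ω)) (U (Y ω))) ∂μ := by
  refine lintegral_comp_le_of_subGaussian hY hη hint hsub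
    (f := fun b y => ENNReal.ofReal (gaussianMixture σ (W b + w b)
      (U b + 2 * y * p b + y ^ 2 * w b)))
    (g := fun b => ENNReal.ofReal (gaussianMixture σ (W b) (U b))) ?_ ?_
    fun b ν _ hν => hν.lintegral_gaussianMixture_le hσ (hW b) (hw b) (hp b)
  · unfold gaussianMixture Function.uncurry
    fun_prop
  · unfold gaussianMixture
    fun_prop

end Conditioning

lemma lintegral_gaussianMixture_le_one {Ω : Type*} {m0 : MeasurableSpace Ω} {μ : Measure Ω}
    [IsProbabilityMeasure μ] {d t : ℕ} {ℱ : Filtration ℕ m0} {σ : ℝ} (hσ : 0 < σ)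
    {X : ℕ → Ω → (Fin d → ℝ)} (hX : ∀ s i, Measurable[ℱ 0] fun ω => X s ω i)
    {η : ℕ → Ω → ℝ} (hη : ∀ s ∈ Finset.Icc 1 t, Measurable[ℱ s] (η s))
    (hint : ∀ s ∈ Finset.Icc 1 t, ∀ c : ℝ, Integrable (fun ω => Real.exp (c * η s ω)) μ)
    (hsub : ∀ s ∈ Finset.Icc 1 t, ∀ c : ℝ, ∀ᵐ ω ∂μ,
      (μ[fun ω' => Real.exp (c * η s ω') | ℱ (s - 1)]) ω ≤ Real.exp (c ^ 2 * σ ^ 2 / 2))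
    {n : ℕ} (hn : n ≤ t) :
    ∫⁻ ω, ENNReal.ofReal (gaussianMixture σ (∑ s ∈ Finset.Icc 1 n, ∑ i, X s ω i ^ 2)
      (∑ i, (∑ s ∈ Finset.Icc 1 n, η s ω * X s ω i) ^ 2)) ∂μ ≤ 1 := by
  induction n with
  | zero => simp [gaussianMixture]
  | succ n ih =>
    refine le_trans ?_ (ih (by omega))
    have hmem : n + 1 ∈ Finset.Icc 1 t := Finset.mem_Icc.2 ⟨by omega, hn⟩
    have hXn : ∀ s i, Measurable[ℱ n] fun ω => X s ω i := fun s i =>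
      (hX s i).mono (ℱ.mono (Nat.zero_le n)) le_rfl
    have hηn : ∀ s ∈ Finset.Icc 1 n, Measurable[ℱ n] (η s) := fun s hs => by
      have := Finset.mem_Icc.1 hs
      exact (hη s (Finset.mem_Icc.2 ⟨this.1, by omega⟩)).mono (ℱ.mono this.2) le_rfl
    have hSn : ∀ i, Measurable[ℱ n] fun ω => ∑ s ∈ Finset.Icc 1 n, η s ω * X s ω i := fun i =>
      Finset.measurable_fun_sum _ fun s hs => (hηn s hs).mul (hXn s i)
    have key := lintegral_gaussianMixture_comp_le (mβ := ℱ n) (μ := μ) (Y := id) (η := η (n + 1))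
      hσ (measurable_id'' (ℱ.le n)) ((hη _ hmem).mono (ℱ.le _) le_rfl) (hint _ hmem)
      (by simpa [MeasurableSpace.comap_id] using hsub _ hmem)
      (W := fun ω => ∑ s ∈ Finset.Icc 1 n, ∑ i, X s ω i ^ 2)
      (w := fun ω => ∑ i, X (n + 1) ω i ^ 2)
      (U := fun ω => ∑ i, (∑ s ∈ Finset.Icc 1 n, η s ω * X s ω i) ^ 2)
      (p := fun ω => ∑ i, (∑ s ∈ Finset.Icc 1 n, η s ω * X s ω i) * X (n + 1) ω i)
      (Finset.measurable_fun_sum _ fun s _ => Finset.measurable_fun_sum _ fun i _ =>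
        (hXn s i).pow_const 2)
      (Finset.measurable_fun_sum _ fun i _ => (hXn _ i).pow_const 2)
      (Finset.measurable_fun_sum _ fun i _ => (hSn i).pow_const 2)
      (Finset.measurable_fun_sum _ fun i _ => (hSn i).mul (hXn _ i))
      (fun ω => by positivity) (fun ω => by positivity)
      (fun ω => Finset.sum_mul_sq_le_sq_mul_sq _ _ _)
    refine Eq.trans_le (lintegral_congr fun ω => ?_) key
    simp only [id, Finset.sum_Icc_succ_top (Nat.le_add_left 1 n)]
    congr 2
    simp only [Finset.mul_sum, ← Finset.sum_add_distrib]
    exact Finset.sum_congr rfl fun i _ => by ring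

lemma sqrt_two_mul_exp_neg_log_le {x : ℝ} (hx : 4 < x) :
    √2 * Real.exp (-(8 * Real.log x)) ≤ 4 / x := by
  have hx0 : 0 < x := by linarith
  have h2 : √2 ≤ 4 := (Real.sqrt_le_left (by norm_num)).2 (by norm_num)
  have h8 : Real.exp (-(8 * Real.log x)) ≤ 1 / x := by
    rw [one_div, ← Real.exp_log (inv_pos.2 hx0), Real.log_inv]
    exact Real.exp_le_exp.2 (by linarith [Real.log_nonneg (by linarith : 1 ≤ x)])
  calc √2 * Real.exp (-(8 * Real.log x)) ≤ 4 * (1 / x) := by gcongr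
    _ = 4 / x := by ring

/-- dimension-free self-normalized bound for vector-valued martingales,
with constant 4.  Let `X s` be `ℱ 0`-measurable random vectors in `ℝ^d` and `η s` be
`ℱ s`-measurable, conditionally `σ`-sub-Gaussian random variables.  Then for every
`δ ∈ (0,1)`, with probability at least `1 − δ`,
`‖∑_{s=1}^t η s • X s‖₂ ≤ 4σ √(∑_{s=1}^t ‖X s‖₂²) √(2 log(4t²/δ))`. -/
theorem dimension_free_self_normalized_bound
    {Ω : Type*} {m0 : MeasurableSpace Ω} (μ : Measure Ω) [IsProbabilityMeasure μ]
    (d t : ℕ) (ℱ : Filtration ℕ m0) (σ : ℝ) (hσ : 0 < σ)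
    (X : ℕ → Ω → (Fin d → ℝ)) (hX : ∀ s, StronglyMeasurable[ℱ 0] (X s))
    (η : ℕ → Ω → ℝ) (hη : ∀ s ∈ Finset.Icc 1 t, StronglyMeasurable[ℱ s] (η s))
    (hint : ∀ s ∈ Finset.Icc 1 t, ∀ c : ℝ, Integrable (fun ω => Real.exp (c * η s ω)) μ)
    (hsub : ∀ s ∈ Finset.Icc 1 t, ∀ c : ℝ, ∀ᵐ ω ∂μ,
      (μ[fun ω' => Real.exp (c * η s ω') | ℱ (s - 1)]) ω ≤ Real.exp (c ^ 2 * σ ^ 2 / 2))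
    (δ : ℝ) (hδ0 : 0 < δ) (hδ1 : δ < 1) :
    ENNReal.ofReal (1 - δ) ≤
      μ {ω | Real.sqrt (∑ i, (∑ s ∈ Finset.Icc 1 t, η s ω * X s ω i) ^ 2) ≤
        4 * σ * Real.sqrt (∑ s ∈ Finset.Icc 1 t, ∑ i, X s ω i ^ 2) *
          Real.sqrt (2 * Real.log (4 * t ^ 2 / δ))} := by
  rcases Nat.eq_zero_or_pos t with rfl | ht
  · simpa using hδ0.le
  have ht1 : (1 : ℝ) ≤ t := by exact_mod_cast ht
  set x : ℝ := 4 * t ^ 2 / δ with hx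
  have hx4 : 4 < x := by
    rw [hx, lt_div_iff₀ hδ0]
    nlinarith
  set L : ℝ := Real.log x with hL
  have hLpos : 0 < L := Real.log_pos (by linarith)
  have hX0 : ∀ s i, Measurable[ℱ 0] fun ω => X s ω i := fun s i =>
    (measurable_pi_apply i).comp (hX s).measurable
  have hXm : ∀ s i, Measurable fun ω => X s ω i := fun s i => (hX0 s i).mono (ℱ.le 0) le_rfl
  have hηm : ∀ s ∈ Finset.Icc 1 t, Measurable (η s) := fun s hs =>
    (hη s hs).measurable.mono (ℱ.le s) le_rfl
  set V : Ω → ℝ := fun ω => ∑ s ∈ Finset.Icc 1 t, ∑ i, X s ω i ^ 2 with hV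
  have hVnn : ∀ ω, 0 ≤ V ω := fun ω => by positivity
  have hV0 : Measurable[ℱ 0] V := Finset.measurable_fun_sum _ fun s _ =>
    Finset.measurable_fun_sum _ fun i _ => (hX0 s i).pow_const 2
  have hVm : Measurable V := hV0.mono (ℱ.le 0) le_rfl
  set S : Ω → ℝ := fun ω => ∑ i, (∑ s ∈ Finset.Icc 1 t, η s ω * X s ω i) ^ 2 with hS
  have hSm : Measurable S := Finset.measurable_fun_sum _ fun i _ =>
    (Finset.measurable_fun_sum _ fun s hs => (hηm s hs).mul (hXm s i)).pow_const 2
  have hVS : ∀ ω, V ω = 0 → S ω = 0 := by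
    intro ω h
    refine Finset.sum_eq_zero fun i _ => ?_
    rw [Finset.sum_eq_zero fun s hs => ?_, zero_pow two_ne_zero]
    have h1 := (Finset.sum_eq_zero_iff_of_nonneg fun s _ => by positivity).1 h s hs
    have h2 := (Finset.sum_eq_zero_iff_of_nonneg fun i _ => by positivity).1 h1 i
      (Finset.mem_univ i)
    rw [pow_eq_zero_iff two_ne_zero] at h2
    rw [h2, mul_zero]
  have hmix := lintegral_gaussianMixture_le_one (μ := μ) (ℱ := ℱ) hσ
    (X := fun s ω i => X s ω i / √(V ω)) (fun s i => (hX0 s i).div hV0.sqrt)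
    (fun s hs => (hη s hs).measurable) hint hsub le_rfl
  set A : Set Ω := {ω | √(S ω) ≤ 4 * σ * √(V ω) * √(2 * L)} with hA
  have hAm : MeasurableSet A := measurableSet_le hSm.sqrt (by fun_prop)
  set ε : ℝ := √2 * Real.exp (-(8 * L)) with hε
  have hεpos : 0 < ε := by positivity
  have hεδ : ε ≤ δ := by
    refine (sqrt_two_mul_exp_neg_log_le hx4).trans ?_
    rw [div_le_iff₀ (by linarith), hx, mul_div_cancel₀ _ hδ0.ne']
    nlinarith
  have hbad : ∀ ω ∈ Aᶜ, ε⁻¹ ≤ gaussianMixture σ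
      (∑ s ∈ Finset.Icc 1 t, ∑ i, (X s ω i / √(V ω)) ^ 2)
      (∑ i, (∑ s ∈ Finset.Icc 1 t, η s ω * (X s ω i / √(V ω))) ^ 2) := by
    intro ω hω
    have hVpos : 0 < V ω := by
      refine (hVnn ω).lt_of_ne' fun h => hω ?_
      simp [hA, h, hVS ω h]
    have e1 : ∑ s ∈ Finset.Icc 1 t, ∑ i, (X s ω i / √(V ω)) ^ 2 = 1 := by
      simp_rw [div_pow, Real.sq_sqrt (hVnn ω), ← Finset.sum_div]
      exact div_self hVpos.ne'
    have e2 : ∑ i, (∑ s ∈ Finset.Icc 1 t, η s ω * (X s ω i / √(V ω))) ^ 2 = S ω / V ω := by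
      simp_rw [← mul_div_assoc, ← Finset.sum_div, div_pow, Real.sq_sqrt (hVnn ω),
        ← Finset.sum_div]
      rfl
    have hlt : 4 * σ * √(V ω) * √(2 * L) < √(S ω) := not_le.1 hω
    have hlt2 : 32 * σ ^ 2 * V ω * L < S ω := by
      have := (Real.lt_sqrt (by positivity)).1 hlt
      rw [mul_pow, mul_pow, Real.sq_sqrt (hVnn ω), Real.sq_sqrt (by positivity)] at this
      linarith
    rw [e1, e2, gaussianMixture, hε, mul_inv, ← Real.exp_neg, neg_neg, one_add_one_eq_two]
    gcongr
    rw [div_div, le_div_iff₀ (by positivity)]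
    linarith
  have hAc : μ Aᶜ ≤ ENNReal.ofReal ε := by
    have h1 := (setLIntegral_mono' (μ := μ) hAm.compl fun ω hω =>
      ENNReal.ofReal_le_ofReal (hbad ω hω)).trans ((setLIntegral_le_lintegral _ _).trans hmix)
    rw [setLIntegral_const, ENNReal.ofReal_inv_of_pos hεpos, mul_comm, ← div_eq_mul_inv] at h1
    simpa using (ENNReal.div_le_iff (by simpa using hεpos) ENNReal.ofReal_ne_top).1 h1
  have hcompl := prob_compl_eq_one_sub (μ := μ) hAm.compl
  rw [compl_compl] at hcompl
  rw [hcompl, ENNReal.ofReal_sub _ hδ0.le, ENNReal.ofReal_one]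
  exact tsub_le_tsub_left (hAc.trans (ENNReal.ofReal_le_ofReal hεδ)) 1
end
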